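/- Let P ≥ 3 and Q ≥ 3 be integers. Define the (P−1)×(P−1) real matrix M, with rows and columns indexed by i, j ∈ {0, 1, …, P−2}, by: M(0,1) = 2; M(i,0) = Q−3 for all 0 ≤ i ≤ P−2; M(i,1) = 1 for all 1 ≤ i ≤ P−2; M(i,i+1) = 1 for all 1 ≤ i ≤ P−3; and all other entries equal to 0. Then for every real number z, det(M − z·I) = (−1)^P · ( (Q−3) + (Q−2)·Σ_{t=1}^{P−2} z^t − z^(P−1) ). -/

import Mathlib

/-- Two arbitrary leading columns, then a bidiagonal pattern below row 0. -/
def tmB (z : ℝ) (n : ℕ) (f g : ℕ → ℝ) : Matrix (Fin (n + 2)) (Fin (n + 2)) ℝ :=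
  fun i j => if (j : ℕ) = 0 then f i else if (j : ℕ) = 1 then g i
    else if (i : ℕ) = 0 then 0 else if (j : ℕ) = (i : ℕ) + 1 then 1
    else if (j : ℕ) = (i : ℕ) then -z else 0

/-- The columns after one elimination step. -/
def tmS (z : ℝ) (f : ℕ → ℝ) : ℕ → ℝ :=
  fun i => if i = 0 then f 0 else if i = 1 then f 2 + z * f 1 else f (i + 1)

lemma tmB_step (z : ℝ) (n : ℕ) (f g : ℕ → ℝ) :
    (tmB z (n + 1) f g).det = - (tmB z n (tmS z f) (tmS z g)).det := by
  have h12 : (2 : Fin (n + 3)) ≠ 1 := by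
    intro h; have := congrArg Fin.val h; simp [Fin.val_ofNat, Nat.mod_eq_of_lt] at this
  have v2 : ((2 : Fin (n + 3)) : ℕ) = 2 := by simp [Fin.val_ofNat, Nat.mod_eq_of_lt]
  have v1 : ((1 : Fin (n + 3)) : ℕ) = 1 := by simp
  rw [← Matrix.det_updateRow_add_smul_self (tmB z (n + 1) f g) h12 z]
  rw [Matrix.det_succ_column _ (2 : Fin (n + 3))]
  rw [Finset.sum_eq_single (1 : Fin (n + 3))]
  · have hent : ∀ (A : Matrix (Fin (n + 2)) (Fin (n + 2)) ℝ), A = tmB z n (tmS z f) (tmS z g) →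
        A.det = (tmB z n (tmS z f) (tmS z g)).det := fun A h => by rw [h]
    rw [hent _ ?_, Matrix.updateRow_ne h12.symm]
    · simp only [tmB, v1, v2]; norm_num
    · ext i j
      have hi : ((Fin.succAbove (1 : Fin (n + 3)) i : Fin (n + 3)) : ℕ)
          = if (i : ℕ) < 1 then (i : ℕ) else i + 1 := by
        simp only [Fin.succAbove, Fin.lt_def, v1, Fin.val_castSucc]; split_ifs <;> simp
      have hj : ((Fin.succAbove (2 : Fin (n + 3)) j : Fin (n + 3)) : ℕ)
          = if (j : ℕ) < 2 then (j : ℕ) else j + 1 := by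
        simp only [Fin.succAbove, Fin.lt_def, v2, Fin.val_castSucc]; split_ifs <;> simp
      simp only [Matrix.submatrix_apply, Matrix.updateRow_apply, Fin.ext_iff, v2, hi,
        Pi.add_apply, Pi.smul_apply, smul_eq_mul, tmB, hj, tmS, v1]
      rcases Nat.lt_or_ge (i : ℕ) 1 with h | h
      · grind
      · simp only [if_neg (Nat.not_lt.mpr h)]
        rcases Nat.lt_or_ge (j : ℕ) 2 with h' | h'
        · simp only [if_pos h']
          grind
        · simp only [if_neg (Nat.not_lt.mpr h')]
          clear hent hi hj
          grind
  · intro b _ hb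
    have hb' : (b : ℕ) ≠ 1 := fun h => hb (Fin.ext (by rw [h, v1]))
    have : (tmB z (n + 1) f g).updateRow 2 (tmB z (n + 1) f g 2 + z • tmB z (n + 1) f g 1) b 2
        = 0 := by
      simp only [Matrix.updateRow_apply, Fin.ext_iff, v2, 
        Pi.add_apply, Pi.smul_apply, smul_eq_mul, tmB, v1]
      grind
    rw [this]; ring
  · simp

lemma tmS_sum (z : ℝ) (n : ℕ) (f : ℕ → ℝ) :
    ∑ i ∈ Finset.range (n + 1), z ^ (n - i) * tmS z f (i + 1)
      = ∑ i ∈ Finset.range (n + 2), z ^ (n + 1 - i) * f (i + 1) := by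
  rw [Finset.sum_range_succ', Finset.sum_range_succ' _ (n + 1), Finset.sum_range_succ' _ n]
  have : ∀ i ∈ Finset.range n, z ^ (n - (i + 1)) * tmS z f (i + 1 + 1)
      = z ^ (n + 1 - (i + 1 + 1)) * f (i + 1 + 1 + 1) := by
    intro i _
    rw [show n + 1 - (i + 1 + 1) = n - (i + 1) by omega]
    simp [tmS]
  rw [Finset.sum_congr rfl this]
  simp [tmS]
  ring

lemma tmB_det (z : ℝ) (n : ℕ) : ∀ (f g : ℕ → ℝ), (tmB z n f g).det = (-1) ^ n *
    (f 0 * ∑ i ∈ Finset.range (n + 1), z ^ (n - i) * g (i + 1)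
      - g 0 * ∑ i ∈ Finset.range (n + 1), z ^ (n - i) * f (i + 1)) := by
  induction n with
  | zero => intro f g; rw [Matrix.det_fin_two]; simp [tmB]
  | succ n ih =>
    intro f g
    rw [tmB_step, ih, tmS_sum, tmS_sum]
    simp only [tmS, if_true]
    ring

/-- Characteristic polynomial of the transfer matrix for strings over
{1,…,Q−1} with no run of P−1 consecutive 1s or (Q−1)s:
det(M − zI) = (−1)^P ((Q−3) + (Q−2)Σ_{t=1}^{P−2} z^t − z^(P−1)). -/
theorem transfer_matrix_char_poly (P Q : ℕ) (hP : 3 ≤ P) (hQ : 3 ≤ Q)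
    (M : Matrix (Fin (P - 1)) (Fin (P - 1)) ℝ)
    (hM : ∀ i j : Fin (P - 1), M i j =
      if (i : ℕ) = 0 ∧ (j : ℕ) = 1 then 2
      else if (j : ℕ) = 0 then (Q : ℝ) - 3
      else if 1 ≤ (i : ℕ) ∧ (j : ℕ) = 1 then 1
      else if 1 ≤ (i : ℕ) ∧ (j : ℕ) = (i : ℕ) + 1 then 1
      else 0) :
    ∀ z : ℝ,
      (M - z • (1 : Matrix (Fin (P - 1)) (Fin (P - 1)) ℝ)).det =
        (-1 : ℝ) ^ P *
          (((Q : ℝ) - 3) + ((Q : ℝ) - 2) * ∑ t ∈ Finset.Icc 1 (P - 2), z ^ t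
            - z ^ (P - 1)) := by
  intro z
  obtain ⟨n, rfl⟩ : ∃ n, P = n + 3 := ⟨P - 3, by omega⟩
  change Matrix (Fin (n + 2)) (Fin (n + 2)) ℝ at M
  have hB : M - z • (1 : Matrix (Fin (n + 2)) (Fin (n + 2)) ℝ)
      = tmB z n (fun i => if i = 0 then (Q : ℝ) - 3 - z else (Q : ℝ) - 3)
          (fun i => if i = 0 then 2 else if i = 1 then 1 - z else 1) := by
    ext i j
    have h := hM i j
    simp only [Matrix.sub_apply, Matrix.smul_apply, Matrix.one_apply, smul_eq_mul, tmB,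
      Fin.ext_iff]
    rw [h]
    grind
  change (M - z • (1 : Matrix (Fin (n + 2)) (Fin (n + 2)) ℝ)).det = _
  rw [hB, tmB_det]
  have e1 : ∑ i ∈ Finset.range (n + 1), z ^ (n - i) = ∑ i ∈ Finset.range (n + 1), z ^ i := by
    rw [← Finset.sum_range_reflect (fun i => z ^ i)]
    simp
  have e2 : ∑ t ∈ Finset.Icc 1 (n + 3 - 2), z ^ t = z * ∑ i ∈ Finset.range (n + 1), z ^ i := by
    rw [show n + 3 - 2 = n + 1 by omega, ← Finset.Ico_add_one_right_eq_Icc,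
      Finset.sum_Ico_eq_sum_range, Finset.mul_sum]
    exact Finset.sum_congr (by simp) (fun i _ => by ring)
  have e3 : ∑ i ∈ Finset.range (n + 1), z ^ (n - i) *
      (if i + 1 = 0 then (2 : ℝ) else if i + 1 = 1 then 1 - z else 1)
      = ∑ i ∈ Finset.range (n + 1), z ^ (n - i) - z ^ (n + 1) := by
    rw [Finset.sum_range_succ', Finset.sum_range_succ']
    simp
    ring
  have e4 : ∑ i ∈ Finset.range (n + 1), z ^ (n - i) *
      (if i + 1 = 0 then (Q : ℝ) - 3 - z else (Q : ℝ) - 3)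
      = (∑ i ∈ Finset.range (n + 1), z ^ (n - i)) * ((Q : ℝ) - 3) := by
    rw [Finset.sum_mul]
    simp
  have e5 := geom_sum_mul z (n + 1)
  rw [e3, e4, e2, e1, show n + 3 - 1 = n + 2 by omega]
  simp only [if_true]
  generalize ∑ i ∈ Finset.range (n + 1), z ^ i = S at *
  have e6 : z ^ (n + 1) = S * (z - 1) + 1 := by linarith
  rw [show z ^ (n + 2) = z * z ^ (n + 1) by ring, e6]
  ring
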